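/- arXiv:1810.10492 — 3 statements merged into one kernel-verified Lean document; each statement's English description precedes it below -/
import Mathlib

section
/- Let p be a prime, V a 3-dimensional vector space over 𝔽_p, and k an algebraic closure of 𝔽_p. If f : Z₁ → k satisfies Σ_{L∈Z₁} f(L) = 0, then τ'(τ(f)) = 0; and if f' : Z₂ → k satisfies Σ_{P∈Z₂} f'(P) = 0, then τ(τ'(f')) = 0. In other words, τ(F₁) ⊆ ker(τ'|_{F₂}) and τ'(F₂) ⊆ ker(τ|_{F₁}). -/
open Module

/-- `Z₁`: the set of lines (1-dimensional linear subspaces) of `V`. -/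
abbrev lines (p : ℕ) (V : Type) [AddCommGroup V] [Module (ZMod p) V] : Type :=
  {L : Submodule (ZMod p) V // finrank (ZMod p) L = 1}

/-- `Z₂`: the set of planes (2-dimensional linear subspaces) of `V`. -/
abbrev planes (p : ℕ) (V : Type) [AddCommGroup V] [Module (ZMod p) V] : Type :=
  {P : Submodule (ZMod p) V // finrank (ZMod p) P = 2}

/-- The map `τ`: `(τ f)(P) = Σ_{L ∈ Z₁, L ⊆ P} f(L)`. -/
noncomputable def tau (p : ℕ) (V : Type) [AddCommGroup V] [Module (ZMod p) V]
    (k : Type) [Field k] (f : lines p V → k) (P : planes p V) : k :=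
  ∑ᶠ L ∈ {L : lines p V | L.1 ≤ P.1}, f L

/-- The map `τ'`: `(τ' f')(L) = Σ_{P ∈ Z₂, L ⊆ P} f'(P)`. -/
noncomputable def tau' (p : ℕ) (V : Type) [AddCommGroup V] [Module (ZMod p) V]
    (k : Type) [Field k] (f' : planes p V → k) (L : lines p V) : k :=
  ∑ᶠ P ∈ {P : planes p V | L.1 ≤ P.1}, f' P

/-- Abstract incidence lemma: two distinct points lie on exactly one common block, and the
number of blocks through a point is `1` in `k`. -/
theorem incidence_aux {A B k : Type} [Finite A] [Finite B] [Field k] (r : A → B → Prop)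
    (h1 : ∀ a a', a ≠ a' → ∃! b, r a b ∧ r a' b)
    (h2 : ∀ a, ((Nat.card {b // r a b} : ℕ) : k) = 1)
    (f : A → k) (hf : ∑ᶠ a, f a = 0) (a : A) :
    ∑ᶠ b ∈ {b | r a b}, ∑ᶠ a' ∈ {a' | r a' b}, f a' = 0 := by
  classical
  have := Fintype.ofFinite A
  have := Fintype.ofFinite B
  have q : ∀ {X : Type} [Fintype X] (s : X → Prop) (g : X → k),
      ∑ᶠ x ∈ {x | s x}, g x = ∑ x, if s x then g x else 0 := by
    intro X _ s g
    rw [finsum_mem_def, finsum_eq_sum_of_fintype]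
    rfl
  rw [finsum_eq_sum_of_fintype] at hf
  simp only [q]
  have e : ∀ b, (if r a b then ∑ a', (if r a' b then f a' else 0) else 0)
      = ∑ a', (if r a b ∧ r a' b then f a' else 0) := by
    intro b
    by_cases h : r a b <;> simp [h]
  rw [Finset.sum_congr rfl (fun b _ => e b), Finset.sum_comm]
  refine Eq.trans ?_ hf
  refine Finset.sum_congr rfl fun a' _ => ?_
  rw [← Finset.sum_filter, Finset.sum_const, nsmul_eq_mul]
  have : ((Finset.univ.filter fun b => r a b ∧ r a' b).card : k) = 1 := by
    by_cases h : a = a'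
    · subst h
      have := h2 a
      rw [Nat.card_eq_fintype_card, Fintype.card_subtype] at this
      simpa using this
    · obtain ⟨b, hb, hu⟩ := h1 a a' h
      have : (Finset.univ.filter fun b => r a b ∧ r a' b) = {b} := by
        ext c
        simp only [Finset.mem_filter, Finset.mem_univ, true_and, Finset.mem_singleton]
        exact ⟨hu c, fun h => h ▸ hb⟩
      simp [this]
  rw [this, one_mul]

theorem card_lines_aux (p : ℕ) [Fact p.Prime] (W : Type) [AddCommGroup W] [Module (ZMod p) W]
    (h : finrank (ZMod p) W = 2) :
    Nat.card {L : Submodule (ZMod p) W // finrank (ZMod p) L = 1} = p + 1 := by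
  rw [← Nat.card_congr (Projectivization.equivSubmodule (ZMod p) W),
    Projectivization.card_of_finrank_two _ _ h, Nat.card_zmod]

theorem finrank_map_inj_aux {K V W : Type} [Field K] [AddCommGroup V] [Module K V]
    [AddCommGroup W] [Module K W] {g : V →ₗ[K] W} (hg : Function.Injective g)
    (S : Submodule K V) : finrank K (S.map g) = finrank K S :=
  (Submodule.equivMapOfInjective g hg S).finrank_eq.symm

theorem card_lines_in_plane (p : ℕ) [Fact p.Prime] (V : Type) [AddCommGroup V]
    [Module (ZMod p) V] (P : planes p V) :
    Nat.card {L : lines p V // L.1 ≤ P.1} = p + 1 := by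
  rw [← card_lines_aux p P.1 P.2]
  let g : {L : Submodule (ZMod p) P.1 // finrank (ZMod p) L = 1} →
      {L : lines p V // L.1 ≤ P.1} := fun L => ⟨⟨L.1.map P.1.subtype, by
        rw [finrank_map_inj_aux P.1.subtype_injective]; exact L.2⟩,
        Submodule.map_subtype_le _ _⟩
  refine (Nat.card_congr (Equiv.ofBijective g ⟨?_, ?_⟩)).symm
  · intro L L' h
    simp only [g, Subtype.mk.injEq] at h
    exact Subtype.ext (Submodule.map_injective_of_injective P.1.subtype_injective h)
  · rintro ⟨⟨L, hL⟩, hLP⟩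
    have e : (L.comap P.1.subtype).map P.1.subtype = L := by
      simpa [Submodule.map_comap_subtype] using hLP
    refine ⟨⟨L.comap P.1.subtype, ?_⟩, ?_⟩
    · rw [← finrank_map_inj_aux P.1.subtype_injective, e]; exact hL
    · exact Subtype.ext (Subtype.ext e)

theorem finrank_comap_mkQ_aux (p : ℕ) [Fact p.Prime] (V : Type) [AddCommGroup V]
    [Module (ZMod p) V] [Module.Finite (ZMod p) V] (L : Submodule (ZMod p) V)
    (M : Submodule (ZMod p) (V ⧸ L)) :
    finrank (ZMod p) (M.comap L.mkQ) = finrank (ZMod p) M + finrank (ZMod p) L := by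
  have h := ((L.mkQ).domRestrict (M.comap L.mkQ)).finrank_range_add_finrank_ker
  rw [LinearMap.range_domRestrict, Submodule.map_comap_eq_of_surjective L.mkQ_surjective,
    LinearMap.ker_domRestrict] at h
  rw [← h]
  congr 1
  rw [← finrank_map_inj_aux (Submodule.subtype_injective (M.comap L.mkQ)),
    Submodule.map_comap_subtype, Submodule.ker_mkQ, inf_eq_right.2 (Submodule.le_comap_mkQ L M)]

theorem card_planes_through_line (p : ℕ) [Fact p.Prime] (V : Type) [AddCommGroup V]
    [Module (ZMod p) V] [Module.Finite (ZMod p) V] (hV : finrank (ZMod p) V = 3)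
    (L : lines p V) :
    Nat.card {P : planes p V // L.1 ≤ P.1} = p + 1 := by
  have hq : finrank (ZMod p) (V ⧸ L.1) = 2 := by
    have := L.1.finrank_quotient_add_finrank
    have := L.2
    omega
  rw [← card_lines_aux p (V ⧸ L.1) hq]
  let g : {M : Submodule (ZMod p) (V ⧸ L.1) // finrank (ZMod p) M = 1} →
      {P : planes p V // L.1 ≤ P.1} := fun M => ⟨⟨M.1.comap L.1.mkQ, by
        rw [finrank_comap_mkQ_aux, M.2, L.2]⟩, Submodule.le_comap_mkQ _ _⟩
  refine (Nat.card_congr (Equiv.ofBijective g ⟨?_, ?_⟩)).symm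
  · intro M M' h
    simp only [g, Subtype.mk.injEq] at h
    exact Subtype.ext (Submodule.comap_injective_of_surjective L.1.mkQ_surjective h)
  · rintro ⟨⟨P, hP⟩, hLP⟩
    have e : (P.map L.1.mkQ).comap L.1.mkQ = P := by
      simpa [Submodule.comap_map_mkQ] using hLP
    refine ⟨⟨P.map L.1.mkQ, ?_⟩, ?_⟩
    · have := finrank_comap_mkQ_aux p V L.1 (P.map L.1.mkQ)
      rw [e, hP, L.2] at this
      omega
    · exact Subtype.ext (Subtype.ext e)

/-- If `Σ_{L ∈ Z₁} f(L) = 0` then `τ'(τ f) = 0`, and if `Σ_{P ∈ Z₂} f'(P) = 0` then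
`τ(τ' f') = 0`: that is, `τ(F₁) ⊆ ker(τ'|_{F₂})` and `τ'(F₂) ⊆ ker(τ|_{F₁})`. -/
theorem stmt7 (p : ℕ) [Fact p.Prime] (V : Type) [AddCommGroup V] [Module (ZMod p) V]
    [Module.Finite (ZMod p) V] (hV : finrank (ZMod p) V = 3)
    (k : Type) [Field k] [Algebra (ZMod p) k] [IsAlgClosure (ZMod p) k] :
    (∀ f : lines p V → k, (∑ᶠ L : lines p V, f L) = 0 →
      tau' p V k (tau p V k f) = 0) ∧
    (∀ f' : planes p V → k, (∑ᶠ P : planes p V, f' P) = 0 →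
      tau p V k (tau' p V k f') = 0) := by
  have : Finite V := Module.finite_of_finite (ZMod p)
  have : Finite (Submodule (ZMod p) V) :=
    Finite.of_injective (fun S => (S : Set V)) SetLike.coe_injective
  have hk : ((p + 1 : ℕ) : k) = 1 := by
    have : CharP k p := charP_of_injective_algebraMap (algebraMap (ZMod p) k).injective p
    simp
  constructor
  · intro f hf
    funext L
    refine incidence_aux (fun (L : lines p V) (P : planes p V) => L.1 ≤ P.1) ?_ ?_ f hf L
    · intro L L' hne
      have hlt : finrank (ZMod p) (L.1 ⊓ L'.1 : Submodule (ZMod p) V) = 0 := by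
        by_contra h
        have a1 := Submodule.eq_of_le_of_finrank_le (inf_le_left : L.1 ⊓ L'.1 ≤ L.1)
          (by rw [L.2]; omega)
        have a2 := Submodule.eq_of_le_of_finrank_le (inf_le_right : L.1 ⊓ L'.1 ≤ L'.1)
          (by rw [L'.2]; omega)
        exact hne (Subtype.ext (a1.symm.trans a2))
      have hs := Submodule.finrank_sup_add_finrank_inf_eq L.1 L'.1
      rw [hlt, L.2, L'.2] at hs
      refine ⟨⟨L.1 ⊔ L'.1, by omega⟩, ⟨le_sup_left, le_sup_right⟩, ?_⟩
      rintro P ⟨h1, h2⟩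
      exact Subtype.ext (Submodule.eq_of_le_of_finrank_le (sup_le h1 h2)
        (by rw [P.2]; omega)).symm
    · intro L
      rw [card_planes_through_line p V hV L, hk]
  · intro f hf
    funext P
    refine incidence_aux (fun (P : planes p V) (L : lines p V) => L.1 ≤ P.1) ?_ ?_ f hf P
    · intro P P' hne
      have hgt : finrank (ZMod p) (P.1 ⊔ P'.1 : Submodule (ZMod p) V) = 3 := by
        have hle := Submodule.finrank_le (P.1 ⊔ P'.1)
        by_contra h
        have a1 := Submodule.eq_of_le_of_finrank_le (le_sup_left : P.1 ≤ P.1 ⊔ P'.1)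
          (by rw [P.2]; omega)
        have a2 := Submodule.eq_of_le_of_finrank_le (le_sup_right : P'.1 ≤ P.1 ⊔ P'.1)
          (by rw [P'.2]; omega)
        exact hne (Subtype.ext (a1.trans a2.symm))
      have hs := Submodule.finrank_sup_add_finrank_inf_eq P.1 P'.1
      rw [hgt, P.2, P'.2] at hs
      refine ⟨⟨P.1 ⊓ P'.1, by omega⟩, ⟨inf_le_left, inf_le_right⟩, ?_⟩
      rintro L ⟨h1, h2⟩
      exact Subtype.ext (Submodule.eq_of_le_of_finrank_le (le_inf h1 h2)
        (by rw [L.2]; change finrank (ZMod p) (P.1 ⊓ P'.1 : Submodule (ZMod p) V) ≤ 1; omega))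
    · intro P
      rw [card_lines_in_plane p V P, hk]
end

section
/- Let p be a prime, V a 3-dimensional vector space over 𝔽_p, and k an algebraic closure of 𝔽_p. The kernel of the restriction of τ' to F₂ equals the image of F₁ under τ: that is, for f' ∈ F₂ one has τ'(f') = 0 if and only if f' = τ(f) for some f ∈ F₁. -/
open Module

/-- Incidence operator of a relation. -/
noncomputable def incOp {A B R : Type} [Fintype A] [CommRing R] (I : A → B → Prop)
    (f : A → R) (b : B) : R := by
  classical exact ∑ a, if I a b then f a else 0

theorem incOp_comp {A B R : Type} [Fintype A] [Fintype B] [CommRing R] (I : A → B → Prop) (p : ℕ)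
    (h1 : ∀ b, Nat.card {a // I a b} = p + 1)
    (h2 : ∀ b b', b ≠ b' → Nat.card {a // I a b ∧ I a b'} = 1) (f : B → R) (b : B) :
    incOp I (incOp (fun b a => I a b) f) b = p * f b + ∑ b', f b' := by
  classical
  have e : incOp I (incOp (fun b a => I a b) f) b
      = ∑ b', (Nat.card {a // I a b ∧ I a b'} : R) * f b' := by
    unfold incOp
    have : ∀ a, (if I a b then (∑ b', if I a b' then f b' else 0) else 0)
        = ∑ b', if I a b ∧ I a b' then f b' else 0 := by
      intro a
      by_cases h : I a b <;> simp [h]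
    simp_rw [this]
    rw [Finset.sum_comm]
    refine Finset.sum_congr rfl fun b' _ => ?_
    rw [← Finset.sum_filter, Finset.sum_const, nsmul_eq_mul, Nat.card_eq_fintype_card,
      Fintype.card_subtype]
  rw [e, ← Finset.add_sum_erase _ _ (Finset.mem_univ b),
    ← Finset.add_sum_erase _ f (Finset.mem_univ b)]
  have : ∑ x ∈ Finset.univ.erase b, (Nat.card {a // I a b ∧ I a x} : R) * f x
      = ∑ x ∈ Finset.univ.erase b, f x := by
    refine Finset.sum_congr rfl fun x hx => ?_
    rw [h2 b x (Finset.ne_of_mem_erase hx).symm]; simp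
  rw [this]
  simp only [and_self, h1]
  push_cast; ring

theorem incOp_const {A B R : Type} [Fintype A] [CommRing R] (I : A → B → Prop) (p : ℕ)
    (h1 : ∀ b, Nat.card {a // I a b} = p + 1) (c : R) (b : B) :
    incOp I (fun _ => c) b = (p + 1) * c := by
  classical
  unfold incOp
  rw [← Finset.sum_filter, Finset.sum_const, nsmul_eq_mul]
  have := h1 b
  rw [Nat.card_eq_fintype_card, Fintype.card_subtype] at this
  rw [this]; push_cast; ring

theorem incOp_sum {A B R : Type} [Fintype A] [Fintype B] [CommRing R] (I : A → B → Prop) (p : ℕ)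
    (h1 : ∀ a, Nat.card {b // I a b} = p + 1) (f : A → R) :
    ∑ b, incOp I f b = (p + 1) * ∑ a, f a := by
  classical
  unfold incOp
  rw [Finset.sum_comm, Finset.mul_sum]
  refine Finset.sum_congr rfl fun a _ => ?_
  have := h1 a
  rw [Nat.card_eq_fintype_card, Fintype.card_subtype] at this
  rw [← Finset.sum_filter, Finset.sum_const, nsmul_eq_mul, this]; push_cast; ring

theorem incOp_map {A B R S : Type} [Fintype A] [CommRing R] [CommRing S] (I : A → B → Prop)
    (φ : R →+* S) (f : A → R) (b : B) : φ (incOp I f b) = incOp I (fun a => φ (f a)) b := by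
  classical
  unfold incOp
  rw [map_sum]
  refine Finset.sum_congr rfl fun a _ => ?_
  split_ifs <;> simp

theorem incOp_sub {A B R : Type} [Fintype A] [CommRing R] (I : A → B → Prop)
    (f g : A → R) (b : B) : incOp I (fun a => f a - g a) b = incOp I f b - incOp I g b := by
  classical
  unfold incOp
  rw [← Finset.sum_sub_distrib]
  refine Finset.sum_congr rfl fun a _ => ?_
  split_ifs <;> simp

theorem incOp_mul {A B R : Type} [Fintype A] [CommRing R] (I : A → B → Prop)
    (c : R) (f : A → R) (b : B) : incOp I (fun a => c * f a) b = c * incOp I f b := by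
  classical
  unfold incOp
  rw [Finset.mul_sum]
  refine Finset.sum_congr rfl fun a _ => ?_
  split_ifs <;> simp

/-- The abstract exactness argument: lift along `R → k = R / p` with `R` free of `p`-torsion. -/
theorem inc_exact {A B R k : Type} [Fintype A] [Fintype B] [CommRing R] [CommRing k]
    (I : A → B → Prop) (p : ℕ)
    (hb : ∀ b, Nat.card {a // I a b} = p + 1)
    (hbb : ∀ b b', b ≠ b' → Nat.card {a // I a b ∧ I a b'} = 1)
    (hA : Nat.card A = p ^ 2 + p + 1)
    (π : R →+* k) (hπ : Function.Surjective π) (hpk : (p : k) = 0)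
    (hker : ∀ x, π x = 0 → ∃ y, x = p * y) (htor : ∀ x y : R, p * x = p * y → x = y)
    (f' : B → k) (hf' : ∑ b, f' b = 0) (h0 : ∀ a, incOp (fun b a => I a b) f' a = 0) :
    ∃ f : A → k, ∑ a, f a = 0 ∧ ∀ b, f' b = incOp I f b := by
  choose s hs using hπ
  obtain ⟨c, hc⟩ := hker (∑ b, s (f' b)) (by rw [map_sum]; simpa [hs] using hf')
  have hg : ∀ a, ∃ y, incOp (fun b a => I a b) (fun b => s (f' b)) a = p * y := fun a =>
    hker _ (by rw [incOp_map]; simpa [hs] using h0 a)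
  choose g hg using hg
  have key : ∀ b, incOp I g b = s (f' b) + c := by
    intro b
    apply htor
    rw [← incOp_mul]
    simp_rw [← hg]
    rw [incOp_comp I p hb hbb, hc]; ring
  have sg : ∑ a, g a = (p + 1) * c := by
    apply htor
    rw [Finset.mul_sum]
    simp_rw [← hg]
    rw [incOp_sum (fun b a => I a b) p hb, hc]; ring
  refine ⟨fun a => π (g a) - π c, ?_, fun b => ?_⟩
  · rw [Finset.sum_sub_distrib, ← map_sum, sg, Finset.sum_const, Finset.card_univ,
      ← Nat.card_eq_fintype_card, hA]
    simp [hpk]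
  · rw [incOp_sub, ← incOp_map, key, incOp_const I p hb]
    simp [hpk, hs]

theorem witt_ker {p : ℕ} [Fact p.Prime] {k : Type} [Field k] [CharP k p] [PerfectRing k p]
    (x : WittVector p k) (hx : WittVector.constantCoeff x = 0) : ∃ y, x = (p : WittVector p k) * y := by
  have h := WittVector.eq_iterate_verschiebung (x := x) (n := 1) (by
    intro i hi
    obtain rfl : i = 0 := by omega
    exact hx)
  obtain ⟨z, hz⟩ := (WittVector.frobenius_bijective p k).2 (x.shift 1)
  refine ⟨z, ?_⟩
  rw [h, Function.iterate_one, ← hz, WittVector.verschiebung_frobenius, mul_comm]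

theorem witt_p_ne {p : ℕ} [Fact p.Prime] {k : Type} [Field k] [CharP k p] :
    (p : WittVector p k) ≠ 0 := WittVector.p_nonzero p k

section counts
variable {p : ℕ} [Fact p.Prime] {V : Type} [AddCommGroup V] [Module (ZMod p) V]
    [Module.Finite (ZMod p) V]

theorem card_lines_of (W : Type) [AddCommGroup W] [Module (ZMod p) W] (n : ℕ)
    (h : finrank (ZMod p) W = n) :
    Nat.card (lines p W) = ∑ i ∈ Finset.range n, p ^ i := by
  rw [← Nat.card_congr (Projectivization.equivSubmodule (ZMod p) W),
    Projectivization.card_of_finrank (ZMod p) W h, Nat.card_zmod]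

theorem card_lines_in (P : planes p V) : Nat.card {L : lines p V // L.1 ≤ P.1} = p + 1 := by
  have e : lines p P.1 ≃ {L : lines p V // L.1 ≤ P.1} :=
    { toFun := fun M => ⟨⟨M.1.map P.1.subtype, by
          rw [Submodule.finrank_map_subtype_eq]; exact M.2⟩, Submodule.map_subtype_le _ _⟩
      invFun := fun L => ⟨L.1.1.comap P.1.subtype, by
          rw [← Submodule.finrank_map_subtype_eq, Submodule.map_comap_subtype,
            inf_eq_right.2 L.2]; exact L.1.2⟩
      left_inv := fun M => Subtype.ext (Submodule.comap_map_eq_of_injective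
          (Submodule.subtype_injective _) _)
      right_inv := fun L => Subtype.ext (Subtype.ext (by
          simp only [Submodule.map_comap_subtype]; exact inf_eq_right.2 L.2)) }
  rw [← Nat.card_congr e, card_lines_of _ 2 P.2]
  simp [Finset.sum_range_succ, add_comm]

theorem finrank_comap_mkQ (L : Submodule (ZMod p) V) (M : Submodule (ZMod p) (V ⧸ L)) :
    finrank (ZMod p) (M.comap L.mkQ) = finrank (ZMod p) M + finrank (ZMod p) L := by
  have h1 := Submodule.finrank_quotient_add_finrank (M.comap L.mkQ)
  have h2 := Submodule.finrank_quotient_add_finrank M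
  have h3 := Submodule.finrank_quotient_add_finrank L
  have h4 : finrank (ZMod p) (V ⧸ M.comap L.mkQ) = finrank (ZMod p) ((V ⧸ L) ⧸ M) := by
    have := (M.mkQ.comp L.mkQ).quotKerEquivOfSurjective
      (M.mkQ_surjective.comp L.mkQ_surjective)
    have hk : LinearMap.ker (M.mkQ.comp L.mkQ) = M.comap L.mkQ := by
      rw [LinearMap.ker_comp, Submodule.ker_mkQ]
    rw [← hk]
    exact this.finrank_eq
  omega

theorem card_planes_on (hV : finrank (ZMod p) V = 3) (L : lines p V) :
    Nat.card {P : planes p V // L.1 ≤ P.1} = p + 1 := by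
  have e : lines p (V ⧸ L.1) ≃ {P : planes p V // L.1 ≤ P.1} :=
    { toFun := fun M => ⟨⟨M.1.comap L.1.mkQ, by
          rw [finrank_comap_mkQ, M.2, L.2]⟩, Submodule.le_comap_mkQ _ _⟩
      invFun := fun P => ⟨P.1.1.map L.1.mkQ, by
          have := finrank_comap_mkQ L.1 (P.1.1.map L.1.mkQ)
          rw [Submodule.comap_map_mkQ, sup_eq_right.2 P.2, P.1.2, L.2] at this
          omega⟩
      left_inv := fun M => Subtype.ext (Submodule.map_comap_eq_self (by simp))
      right_inv := fun P => Subtype.ext (Subtype.ext (by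
          simp only [Submodule.comap_map_mkQ]; exact sup_eq_right.2 P.2)) }
  have h3 := Submodule.finrank_quotient_add_finrank L.1
  rw [← Nat.card_congr e, card_lines_of _ 2 (by rw [L.2] at h3; omega)]
  simp [Finset.sum_range_succ, add_comm]

theorem card_inter (hV : finrank (ZMod p) V = 3) (P Q : planes p V) (h : P ≠ Q) :
    Nat.card {L : lines p V // L.1 ≤ P.1 ∧ L.1 ≤ Q.1} = 1 := by
  have h1 := Submodule.finrank_sup_add_finrank_inf_eq P.1 Q.1
  have h2 := Submodule.finrank_le (P.1 ⊔ Q.1)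
  have h3 : finrank (ZMod p) P.1 < finrank (ZMod p) (P.1 ⊔ Q.1 : Submodule (ZMod p) V) := by
    apply Submodule.finrank_lt_finrank_of_lt
    refine lt_of_le_of_ne le_sup_left fun e => h ?_
    have : Q.1 ≤ P.1 := by rw [e]; exact le_sup_right
    exact Subtype.ext (Submodule.eq_of_le_of_finrank_eq this (by rw [P.2, Q.2])).symm
  rw [P.2] at h3
  rw [P.2, Q.2] at h1
  have h4 : finrank (ZMod p) (P.1 ⊓ Q.1 : Submodule (ZMod p) V) = 1 := by omega
  rw [Nat.card_eq_one_iff_unique]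
  refine ⟨⟨fun a b => ?_⟩, ⟨⟨⟨_, h4⟩, inf_le_left, inf_le_right⟩⟩⟩
  have key : ∀ a : {L : lines p V // L.1 ≤ P.1 ∧ L.1 ≤ Q.1}, a.1.1 = P.1 ⊓ Q.1 := fun a =>
    Submodule.eq_of_le_of_finrank_eq (le_inf a.2.1 a.2.2) (by rw [h4, a.1.2])
  exact Subtype.ext (Subtype.ext ((key a).trans (key b).symm))

theorem card_join (L M : lines p V) (h : L ≠ M) :
    Nat.card {P : planes p V // L.1 ≤ P.1 ∧ M.1 ≤ P.1} = 1 := by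
  have h1 := Submodule.finrank_sup_add_finrank_inf_eq L.1 M.1
  have h3 : finrank (ZMod p) (L.1 ⊓ M.1 : Submodule (ZMod p) V) < finrank (ZMod p) L.1 := by
    apply Submodule.finrank_lt_finrank_of_lt
    refine lt_of_le_of_ne inf_le_left fun e => h ?_
    have : L.1 ≤ M.1 := by rw [← e]; exact inf_le_right
    exact Subtype.ext (Submodule.eq_of_le_of_finrank_eq this (by rw [L.2, M.2]))
  rw [L.2] at h3
  rw [L.2, M.2] at h1
  have h4 : finrank (ZMod p) (L.1 ⊔ M.1 : Submodule (ZMod p) V) = 2 := by omega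
  rw [Nat.card_eq_one_iff_unique]
  refine ⟨⟨fun a b => ?_⟩, ⟨⟨⟨_, h4⟩, le_sup_left, le_sup_right⟩⟩⟩
  have key : ∀ a : {P : planes p V // L.1 ≤ P.1 ∧ M.1 ≤ P.1}, L.1 ⊔ M.1 = a.1.1 := fun a =>
    Submodule.eq_of_le_of_finrank_eq (sup_le a.2.1 a.2.2) (by rw [h4, a.1.2])
  exact Subtype.ext (Subtype.ext ((key a).symm.trans (key b)))

end counts

theorem finsum_incOp {A B R : Type} [Fintype A] [CommRing R] (I : A → B → Prop)
    (f : A → R) (b : B) : (∑ᶠ a ∈ {a | I a b}, f a) = incOp I f b := by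
  classical
  unfold incOp
  rw [finsum_eq_sum_of_fintype]
  refine Finset.sum_congr rfl fun a _ => ?_
  by_cases h : I a b <;> simp [h]

/-- For `f' ∈ F₂` (i.e. `Σ_{P ∈ Z₂} f'(P) = 0`), one has `τ'(f') = 0` if and only if
`f' = τ(f)` for some `f ∈ F₁`: the kernel of `τ'|_{F₂}` equals the image of `F₁` under `τ`. -/
theorem stmt9 (p : ℕ) [Fact p.Prime] (V : Type) [AddCommGroup V] [Module (ZMod p) V]
    [Module.Finite (ZMod p) V] (hV : finrank (ZMod p) V = 3)
    (k : Type) [Field k] [Algebra (ZMod p) k] [IsAlgClosure (ZMod p) k]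
    (f' : planes p V → k) (hf' : (∑ᶠ P : planes p V, f' P) = 0) :
    tau' p V k f' = 0 ↔
      ∃ f : lines p V → k, (∑ᶠ L : lines p V, f L) = 0 ∧ f' = tau p V k f := by
  have : Finite V := Module.finite_of_finite (ZMod p)
  have : Finite (Submodule (ZMod p) V) := inferInstance
  have i1 : Fintype (lines p V) := Fintype.ofFinite _
  have i2 : Fintype (planes p V) := Fintype.ofFinite _
  have : IsAlgClosed k := IsAlgClosure.isAlgClosed (ZMod p)
  have : CharP k p := charP_of_injective_algebraMap (algebraMap (ZMod p) k).injective p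
  have : PerfectRing k p := inferInstance
  have hpk : (p : k) = 0 := CharP.cast_eq_zero k p
  let I : lines p V → planes p V → Prop := fun L P => L.1 ≤ P.1
  have ht : ∀ f : lines p V → k, tau p V k f = incOp I f := fun f => by
    funext P; exact finsum_incOp I f P
  have ht' : tau' p V k f' = incOp (fun P L => I L P) f' := by
    funext L; exact finsum_incOp (fun P L => I L P) f' L
  simp only [finsum_eq_sum_of_fintype] at hf' ⊢
  rw [ht']
  constructor
  · intro h
    obtain ⟨f, hf, hff⟩ := inc_exact I p card_lines_in (card_inter hV)
      (by rw [card_lines_of V 3 hV]; simp [Finset.sum_range_succ]; ring)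
      (WittVector.constantCoeff (p := p) (R := k))
      (fun x => ⟨WittVector.teichmuller p x, WittVector.teichmuller_coeff_zero p x⟩) hpk
      witt_ker (fun x y hxy => mul_left_cancel₀ witt_p_ne hxy) f' hf' (fun a => congrFun h a)
    exact ⟨f, hf, by rw [ht]; funext b; exact hff b⟩
  · rintro ⟨f, hf, rfl⟩
    funext L
    rw [ht]
    have := incOp_comp (fun P L => I L P) p (card_planes_on hV) card_join f L
    refine this.trans ?_
    simp [hpk, hf]
end

section
/- Let p be a prime, V a 3-dimensional vector space over 𝔽_p, and k an algebraic closure of 𝔽_p. Let M = ker(τ|_{F₁}) and M' = ker(τ'|_{F₂}). Then dim_k M = dim_k M' = p(p+1)/2. -/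
open Module

/-- The collection of submodules of a finitely generated module over `ZMod p` (with `p ≠ 0`)
is finite. -/
instance submoduleFinite (p : ℕ) [NeZero p] (V : Type) [AddCommGroup V]
    [Module (ZMod p) V] [Module.Finite (ZMod p) V] : Finite (Submodule (ZMod p) V) := by
  haveI : Finite V := Module.finite_of_finite (ZMod p)
  exact Finite.of_injective (fun s => (s : Set V)) SetLike.coe_injective

/-- Summing the values of a function on a finite type, as a linear map. -/
noncomputable def sumLin (ι k : Type) [Finite ι] [Field k] : (ι → k) →ₗ[k] k where
  toFun f := ∑ᶠ i, f i
  map_add' f g := finsum_add_distrib (Set.toFinite _) (Set.toFinite _)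
  map_smul' c f := by
    simpa using (smul_finsum' c (f := f) (Set.toFinite _)).symm

/-- The map `τ`, `(τ f)(P) = Σ_{L ∈ Z₁, L ⊆ P} f(L)`, as a linear map. -/
noncomputable def tauLin (p : ℕ) [NeZero p] (V : Type) [AddCommGroup V] [Module (ZMod p) V]
    [Module.Finite (ZMod p) V] (k : Type) [Field k] :
    (lines p V → k) →ₗ[k] (planes p V → k) where
  toFun f P := ∑ᶠ L ∈ {L : lines p V | L.1 ≤ P.1}, f L
  map_add' f g := by
    funext P
    exact finsum_mem_add_distrib (Set.toFinite _)
  map_smul' c f := by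
    funext P
    simp only [RingHom.id_apply, Pi.smul_apply, smul_eq_mul]
    rw [finsum_mem_eq_finite_toFinset_sum _ (Set.toFinite _),
      finsum_mem_eq_finite_toFinset_sum _ (Set.toFinite _), Finset.mul_sum]

/-- The map `τ'`, `(τ' f')(L) = Σ_{P ∈ Z₂, L ⊆ P} f'(P)`, as a linear map. -/
noncomputable def tauLin' (p : ℕ) [NeZero p] (V : Type) [AddCommGroup V] [Module (ZMod p) V]
    [Module.Finite (ZMod p) V] (k : Type) [Field k] :
    (planes p V → k) →ₗ[k] (lines p V → k) where
  toFun f' L := ∑ᶠ P ∈ {P : planes p V | L.1 ≤ P.1}, f' P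
  map_add' f' g' := by
    funext L
    exact finsum_mem_add_distrib (Set.toFinite _)
  map_smul' c f' := by
    funext L
    simp only [RingHom.id_apply, Pi.smul_apply, smul_eq_mul]
    rw [finsum_mem_eq_finite_toFinset_sum _ (Set.toFinite _),
      finsum_mem_eq_finite_toFinset_sum _ (Set.toFinite _), Finset.mul_sum]


abbrev Expo (p : ℕ) : Type := ↥(Finset.piAntidiag (Finset.univ : Finset (Fin 3)) (p - 1))

theorem card_expo (p : ℕ) [hp : Fact p.Prime] : Fintype.card (Expo p) = p * (p + 1) / 2 := by
  have h2 := hp.out.two_le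
  rw [Fintype.card_coe, ← Finset.map_sym_eq_piAntidiag, Finset.card_map, Finset.sym_univ,
    Finset.card_univ, Sym.card_sym_eq_choose, Fintype.card_fin]
  have : 3 + (p - 1) - 1 = p + 1 := by omega
  rw [this, ← Nat.choose_symm (by omega)]
  have : p + 1 - (p - 1) = 2 := by omega
  rw [this, Nat.choose_two_right, Nat.add_sub_cancel, mul_comm]

theorem expo_sum {p : ℕ} (e : Expo p) : ∑ i, e.1 i = p - 1 := by
  have := e.2
  rw [Finset.mem_piAntidiag] at this
  exact this.1

theorem multi_ne {p : ℕ} [hp : Fact p.Prime] (k : Type) [Field k] [CharP k p] (e : Expo p) :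
    ((Nat.multinomial Finset.univ e.1 : ℕ) : k) ≠ 0 := by
  intro h
  rw [CharP.cast_eq_zero_iff k p] at h
  have h2 : p ∣ (∑ i, e.1 i).factorial := by
    rw [← Nat.multinomial_spec]
    exact h.mul_left _
  rw [expo_sum, hp.out.dvd_factorial] at h2
  have := hp.out.two_le
  omega

/-- `r` picks a representative of every point of the projective plane. -/
structure GoodRep (p : ℕ) {ι : Type} (r : ι → Fin 3 → ZMod p) : Prop where
  ne : ∀ i, r i ≠ 0
  ex : ∀ v, v ≠ 0 → ∃ i, ∃ t : ZMod p, v = t • r i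
  inj : ∀ i j, ∀ t : ZMod p, r i = t • r j → i = j

theorem GoodRep.card {p : ℕ} [hp : Fact p.Prime] {ι : Type} [Fintype ι]
    {r : ι → Fin 3 → ZMod p} (h : GoodRep p r) : Fintype.card ι = p * (p + 1) + 1 := by
  classical
  let f : ι × (ZMod p)ˣ → {v : Fin 3 → ZMod p // v ≠ 0} := fun x =>
    ⟨(x.2 : ZMod p) • r x.1, smul_ne_zero x.2.ne_zero (h.ne _)⟩
  have hf : Function.Bijective f := by
    constructor
    · rintro ⟨i, t⟩ ⟨j, u⟩ hh
      have h1 : (t : ZMod p) • r i = (u : ZMod p) • r j := congrArg Subtype.val hh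
      have h2 : i = j := by
        apply h.inj i j ((t⁻¹ : (ZMod p)ˣ) * u)
        rw [mul_smul, ← h1, smul_smul, Units.inv_mul, one_smul]
      subst h2
      have h3 := smul_left_injective (ZMod p) (h.ne i) h1
      rw [Units.ext h3]
    · rintro ⟨v, hv⟩
      obtain ⟨i, t, ht⟩ := h.ex v hv
      have : t ≠ 0 := by
        rintro rfl
        exact hv (by simpa using ht)
      exact ⟨(i, Units.mk0 t this), Subtype.ext ht.symm⟩
  have hc := Fintype.card_of_bijective hf
  rw [Fintype.card_prod, ZMod.card_units, Fintype.card_subtype_compl, Fintype.card_subtype_eq] at hc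
  simp only [Fintype.card_pi, ZMod.card, Finset.prod_const, Finset.card_univ, Fintype.card_fin] at hc
  obtain ⟨q, rfl⟩ : ∃ q, p = q + 1 := ⟨p - 1, by have := hp.out.two_le; omega⟩
  have hq : 0 < q := by have := hp.out.two_le; omega
  have e : (q + 1) ^ 3 - 1 = ((q + 1) * (q + 1 + 1) + 1) * q := by
    apply Nat.sub_eq_of_eq_add; ring
  rw [e, Nat.add_sub_cancel] at hc
  exact Nat.eq_of_mul_eq_mul_right hq hc

/-- monomial value -/
def mon {p : ℕ} (e : Expo p) (v : Fin 3 → ZMod p) : ZMod p := ∏ i, v i ^ e.1 i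

theorem mon_smul {p : ℕ} [hp : Fact p.Prime] (e : Expo p) (t : ZMod p) (ht : t ≠ 0)
    (v : Fin 3 → ZMod p) : mon e (t • v) = mon e v := by
  simp only [mon, Pi.smul_apply, smul_eq_mul, mul_pow, Finset.prod_mul_distrib]
  rw [Finset.prod_pow_eq_pow_sum, expo_sum, ZMod.pow_card_sub_one_eq_one ht, one_mul]

theorem sum_mon {p : ℕ} [hp : Fact p.Prime] (e : Expo p) : ∑ v, mon e v = 0 := by
  have h2 := hp.out.two_le
  obtain ⟨i, hi⟩ : ∃ i, e.1 i < p - 1 := by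
    by_contra! hcon
    have h := expo_sum e
    rw [Fin.sum_univ_three] at h
    have := hcon 0; have := hcon 1; have := hcon 2
    omega
  have : ∏ i, ∑ x : ZMod p, x ^ e.1 i = ∑ v, mon e v := by
    rw [Finset.prod_univ_sum, Fintype.piFinset_univ]; rfl
  rw [← this]
  apply Finset.prod_eq_zero (Finset.mem_univ i)
  apply FiniteField.sum_pow_lt_card_sub_one
  rwa [ZMod.card]

theorem mon_zero {p : ℕ} [hp : Fact p.Prime] (e : Expo p) : mon e 0 = 0 := by
  have h2 := hp.out.two_le
  simp only [mon, Pi.zero_apply]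
  rw [Finset.prod_pow_eq_pow_sum, expo_sum, zero_pow (by omega)]

theorem key {p : ℕ} [hp : Fact p.Prime] {k : Type} [Field k] [Algebra (ZMod p) k] {ι : Type}
    {r : ι → Fin 3 → ZMod p} (hr : GoodRep p r) (c : k) (d : Expo p → k)
    (h : ∀ i, c + ∑ e, d e * algebraMap (ZMod p) k (mon e (r i)) = 0) : c = 0 ∧ ∀ e, d e = 0 := by
  classical
  have h2 := hp.out.two_le
  have hv : ∀ v, v ≠ 0 → c + ∑ e, d e * algebraMap (ZMod p) k (mon e v) = 0 := by
    intro v hv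
    obtain ⟨i, t, rfl⟩ := hr.ex v hv
    have : t ≠ 0 := by
      rintro rfl
      simp at hv
    simp only [mon_smul _ t this]
    exact h i
  have hc : c = 0 := by
    have h3 : ∑ v : Fin 3 → ZMod p, (c + ∑ e, d e * algebraMap (ZMod p) k (mon e v)) = c := by
      rw [Finset.sum_eq_single 0]
      · simp [mon_zero]
      · intro v _ hv'; exact hv v hv'
      · simp
    rw [Finset.sum_add_distrib, Finset.sum_comm] at h3
    simp only [← Finset.mul_sum, ← map_sum, sum_mon] at h3
    have : CharP k p := charP_of_injective_algebraMap (algebraMap (ZMod p) k).injective p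
    simpa using h3.symm
  refine ⟨hc, ?_⟩
  have hall : ∀ v, ∑ e, d e * algebraMap (ZMod p) k (mon e v) = 0 := by
    intro v
    by_cases h0 : v = 0
    · subst h0; simp [mon_zero]
    · simpa [hc] using hv v h0
  let P : MvPolynomial (Fin 3) k :=
    ∑ e : Expo p, MvPolynomial.monomial (Finsupp.equivFunOnFinite.symm e.1) (d e)
  have hco : ∀ e : Expo p, P.coeff (Finsupp.equivFunOnFinite.symm e.1) = d e := by
    intro e
    simp only [P, MvPolynomial.coeff_sum, MvPolynomial.coeff_monomial]
    rw [Finset.sum_eq_single e]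
    · simp
    · intro b _ hb
      rw [if_neg]
      intro h'
      exact hb (Subtype.ext (Finsupp.equivFunOnFinite.symm.injective h'))
    · simp
  have hP : P = 0 := by
    apply MvPolynomial.eq_zero_of_eval_zero_at_prod_finset P
      (fun _ => Finset.univ.image (algebraMap (ZMod p) k))
    · intro i
      rw [Finset.card_image_of_injective _ (algebraMap (ZMod p) k).injective, Finset.card_univ,
        ZMod.card]
      refine lt_of_le_of_lt (MvPolynomial.degreeOf_sum_le _ _ _) ?_
      rw [Finset.sup_lt_iff (by simp; omega)]
      intro e _
      refine lt_of_le_of_lt (b := e.1 i) ?_ ?_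
      · by_cases hd : d e = 0
        · simp [hd]
        · rw [MvPolynomial.degreeOf_monomial_eq _ _ hd]; simp
      · have := Finset.single_le_sum (f := e.1) (fun _ _ => Nat.zero_le _) (Finset.mem_univ i)
        rw [expo_sum] at this
        omega
    · intro x hx
      simp only [Finset.mem_image, Finset.mem_univ, true_and] at hx
      choose v hv using hx
      rw [← hall v]
      simp only [P, map_sum, MvPolynomial.eval_monomial, mon, map_prod, map_pow, hv]
      refine Finset.sum_congr rfl fun e _ => ?_
      rw [Finsupp.prod_fintype _ _ (by simp)]
      simp
  intro e
  rw [← hco e, hP, MvPolynomial.coeff_zero]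

theorem indicator_eq {p : ℕ} [hp : Fact p.Prime] (a v : Fin 3 → ZMod p) :
    (if a ⬝ᵥ v = 0 then (1 : ZMod p) else 0) =
      1 - ∑ e : Expo p, (Nat.multinomial Finset.univ e.1 : ZMod p) * (mon e a * mon e v) := by
  have h2 := hp.out.two_le
  have : (a ⬝ᵥ v) ^ (p - 1) =
      ∑ e : Expo p, (Nat.multinomial Finset.univ e.1 : ZMod p) * (mon e a * mon e v) := by
    rw [dotProduct, Finset.sum_pow_eq_sum_piAntidiag, ← Finset.sum_coe_sort]
    refine Finset.sum_congr rfl fun e _ => ?_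
    simp only [mon, mul_pow, Finset.prod_mul_distrib]
  rw [← this]
  split_ifs with h
  · rw [h, zero_pow (by omega), sub_zero]
  · rw [ZMod.pow_card_sub_one_eq_one h, sub_self]

theorem core {p : ℕ} [hp : Fact p.Prime] {k : Type} [Field k] [Algebra (ZMod p) k]
    {ι κ : Type} [Fintype ι] {r : ι → Fin 3 → ZMod p} (hr : GoodRep p r)
    {s : κ → Fin 3 → ZMod p} (hs : GoodRep p s) (K : Submodule k (ι → k))
    (hK : ∀ f, f ∈ K ↔ (∑ i, f i = 0 ∧ ∀ j, ∑ i, (if s j ⬝ᵥ r i = 0 then f i else 0) = 0)) :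
    finrank k K = p * (p + 1) / 2 := by
  classical
  have hch : CharP k p := charP_of_injective_algebraMap (algebraMap (ZMod p) k).injective p
  let C : Matrix (Option (Expo p)) ι k := fun o i =>
    o.elim 1 (fun e => algebraMap (ZMod p) k (mon e (r i)))
  have hKC : K = LinearMap.ker C.mulVecLin := by
    ext f
    have hC : f ∈ LinearMap.ker C.mulVecLin ↔
        (∑ i, f i = 0 ∧ ∀ e : Expo p, ∑ i, algebraMap (ZMod p) k (mon e (r i)) * f i = 0) := by
      rw [LinearMap.mem_ker, Matrix.mulVecLin_apply, funext_iff, Option.forall]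
      simp [Matrix.mulVec, dotProduct, C]
    have hA : ∀ j, ∑ i, (if s j ⬝ᵥ r i = 0 then f i else 0) =
        ∑ i, f i + ∑ e : Expo p, (-((Nat.multinomial Finset.univ e.1 : ℕ) : k) *
          ∑ i, algebraMap (ZMod p) k (mon e (r i)) * f i) *
            algebraMap (ZMod p) k (mon e (s j)) := by
      intro j
      have h1 : ∀ i, (if s j ⬝ᵥ r i = 0 then f i else 0) = f i *
          algebraMap (ZMod p) k (if s j ⬝ᵥ r i = 0 then (1 : ZMod p) else 0) := by
        intro i; split_ifs <;> simp
      simp only [h1, indicator_eq, map_sub, map_one, map_sum, map_mul, map_natCast, mul_sub,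
        mul_one, Finset.sum_sub_distrib, Finset.mul_sum, Finset.sum_mul]
      rw [sub_eq_add_neg, Finset.sum_comm, ← Finset.sum_neg_distrib]
      congr 1
      refine Finset.sum_congr rfl fun e _ => ?_
      rw [← Finset.sum_neg_distrib]
      refine Finset.sum_congr rfl fun i _ => ?_
      ring
    rw [hK, hC]
    constructor
    · rintro ⟨h0, h1⟩
      refine ⟨h0, fun e => ?_⟩
      have := (key hs _ _ (fun j => (hA j).symm.trans (h1 j))).2 e
      rcases mul_eq_zero.1 this with h | h
      · exact absurd (neg_eq_zero.1 h) (multi_ne k e)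
      · exact h
    · rintro ⟨h0, h1⟩
      refine ⟨h0, fun j => ?_⟩
      rw [hA j, h0]
      simp [h1]
  have hrank : C.rank = Fintype.card (Option (Expo p)) := by
    apply LinearIndependent.rank_matrix
    rw [Fintype.linearIndependent_iff]
    intro g hg
    rw [Fintype.sum_option] at hg
    have := key (k := k) hr (g none) (fun e => g (some e)) (fun i => by
      have := congrFun hg i
      simpa [C, Matrix.row] using this)
    intro o
    cases o with
    | none => exact this.1
    | some e => exact this.2 e
  have hrn := LinearMap.finrank_range_add_finrank_ker C.mulVecLin
  rw [← Matrix.rank, hrank, ← hKC, Module.finrank_fintype_fun_eq_card, hr.card,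
    Fintype.card_option, card_expo] at hrn
  have he : 2 ∣ p * (p + 1) := (Nat.even_mul_succ_self p).two_dvd
  omega

theorem lines_rep {p : ℕ} [hp : Fact p.Prime] {V : Type} [AddCommGroup V] [Module (ZMod p) V]
    [Module.Finite (ZMod p) V] (b : Basis (Fin 3) (ZMod p) V) :
    ∃ r : lines p V → Fin 3 → ZMod p, GoodRep p r ∧
      ∀ L : lines p V, L.1 = Submodule.span (ZMod p) {b.equivFun.symm (r L)} := by
  have h1 : ∀ L : lines p V, ∃ v : V, v ≠ 0 ∧ L.1 = Submodule.span (ZMod p) {v} := by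
    intro L
    obtain ⟨v, hv0, hv⟩ := finrank_eq_one_iff'.1 L.2
    refine ⟨v, by simpa using hv0, le_antisymm ?_ ?_⟩
    · intro w hw
      obtain ⟨c, hc⟩ := hv ⟨w, hw⟩
      exact Submodule.mem_span_singleton.2 ⟨c, congrArg Subtype.val hc⟩
    · rw [Submodule.span_singleton_le_iff_mem]; exact v.2
  choose v hv0 hv using h1
  refine ⟨fun L => b.equivFun (v L), ⟨?_, ?_, ?_⟩, ?_⟩
  · intro L
    simpa using hv0 L
  · intro w hw
    have hw' : b.equivFun.symm w ≠ 0 := (LinearEquiv.map_ne_zero_iff _).2 hw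
    let L : lines p V := ⟨Submodule.span (ZMod p) {b.equivFun.symm w}, finrank_span_singleton hw'⟩
    have hm : b.equivFun.symm w ∈ L.1 := Submodule.mem_span_singleton_self _
    rw [hv L] at hm
    obtain ⟨t, ht⟩ := Submodule.mem_span_singleton.1 hm
    refine ⟨L, t, ?_⟩
    rw [← map_smul, ht, LinearEquiv.apply_symm_apply]
  · intro L M t h
    rw [← map_smul] at h
    have h := b.equivFun.injective h
    have ht : t ≠ 0 := by
      rintro rfl
      exact hv0 L (by simpa using h)
    apply Subtype.ext
    rw [hv L, hv M, h]
    exact Submodule.span_singleton_smul_eq ht.isUnit _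
  · intro L
    rw [LinearEquiv.symm_apply_apply]
    exact hv L

theorem planes_rep {p : ℕ} [hp : Fact p.Prime] {V : Type} [AddCommGroup V] [Module (ZMod p) V]
    [Module.Finite (ZMod p) V] (hV : finrank (ZMod p) V = 3) (b : Basis (Fin 3) (ZMod p) V) :
    ∃ s : planes p V → Fin 3 → ZMod p, GoodRep p s ∧
      ∀ P : planes p V, P.1 = LinearMap.ker (b.constr (ZMod p) (s P)) := by
  have h1 : ∀ P : planes p V, ∃ φ : V →ₗ[ZMod p] ZMod p, φ ≠ 0 ∧ P.1 = LinearMap.ker φ := by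
    intro P
    have hP := P.2
    have hlt : P.1 < ⊤ := by
      rw [lt_top_iff_ne_top]
      intro h
      rw [h, finrank_top, hV] at hP
      omega
    obtain ⟨φ, hφ, hle⟩ := Submodule.exists_le_ker_of_lt_top _ hlt
    refine ⟨φ, hφ, Submodule.eq_of_le_of_finrank_eq hle ?_⟩
    have := Module.Dual.finrank_ker_add_one_of_ne_zero hφ
    omega
  choose φ hφ0 hφ using h1
  refine ⟨fun P => (b.constr (ZMod p)).symm (φ P), ⟨?_, ?_, ?_⟩, ?_⟩
  · intro P
    simpa using hφ0 P
  · intro w hw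
    have hw' : b.constr (ZMod p) w ≠ 0 := by simpa using hw
    have hd := Module.Dual.finrank_ker_add_one_of_ne_zero hw'
    let P : planes p V := ⟨LinearMap.ker (b.constr (ZMod p) w), by omega⟩
    have hm : b.constr (ZMod p) w ∈ Submodule.span (ZMod p) (Set.range fun _ : Unit => φ P) := by
      apply mem_span_of_iInf_ker_le_ker
      rw [iInf_const, ← hφ P]
    rw [Set.range_const] at hm
    obtain ⟨t, ht⟩ := Submodule.mem_span_singleton.1 hm
    refine ⟨P, t, ?_⟩
    rw [← map_smul, ht, LinearEquiv.symm_apply_apply]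
  · intro P Q t h
    rw [← map_smul] at h
    have h := (b.constr (ZMod p)).symm.injective h
    have ht : t ≠ 0 := by
      rintro rfl
      exact hφ0 P (by simpa using h)
    apply Subtype.ext
    rw [hφ P, hφ Q, h]
    exact LinearMap.ker_smul _ _ ht
  · intro P
    rw [LinearEquiv.apply_symm_apply]
    exact hφ P

/-- `M = ker(τ|_{F₁})` and `M' = ker(τ'|_{F₂})` both have dimension `p(p+1)/2` over `k`. -/
theorem stmt10 (p : ℕ) [Fact p.Prime] (V : Type) [AddCommGroup V] [Module (ZMod p) V]
    [Module.Finite (ZMod p) V] (hV : finrank (ZMod p) V = 3)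
    (k : Type) [Field k] [Algebra (ZMod p) k] [IsAlgClosure (ZMod p) k] :
    finrank k
      (LinearMap.ker (sumLin (lines p V) k) ⊓ LinearMap.ker (tauLin p V k) :
        Submodule k (lines p V → k)) = p * (p + 1) / 2 ∧
    finrank k
      (LinearMap.ker (sumLin (planes p V) k) ⊓ LinearMap.ker (tauLin' p V k) :
        Submodule k (planes p V → k)) = p * (p + 1) / 2 := by
  classical
  let b : Basis (Fin 3) (ZMod p) V := finBasisOfFinrankEq (ZMod p) V hV
  obtain ⟨r, hr, hL⟩ := lines_rep b
  obtain ⟨s, hs, hP⟩ := planes_rep hV b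
  have hinc : ∀ (L : lines p V) (P : planes p V), L.1 ≤ P.1 ↔ s P ⬝ᵥ r L = 0 := by
    intro L P
    rw [hL L, hP P, Submodule.span_singleton_le_iff_mem, LinearMap.mem_ker,
      Basis.constr_apply_fintype, LinearEquiv.apply_symm_apply, dotProduct]
    simp only [smul_eq_mul, mul_comm]
  letI : Fintype (lines p V) := Fintype.ofFinite _
  letI : Fintype (planes p V) := Fintype.ofFinite _
  constructor
  · refine core hr hs _ fun f => ?_
    rw [Submodule.mem_inf, LinearMap.mem_ker, LinearMap.mem_ker, funext_iff]
    have h1 : sumLin (lines p V) k f = ∑ i, f i := finsum_eq_sum_of_fintype f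
    have h2 : ∀ P, tauLin p V k f P = ∑ L, if s P ⬝ᵥ r L = 0 then f L else 0 := by
      intro P
      have : tauLin p V k f P = ∑ᶠ L ∈ {L : lines p V | L.1 ≤ P.1}, f L := rfl
      rw [this, finsum_mem_eq_finite_toFinset_sum _ (Set.toFinite _), ← Finset.sum_filter]
      refine Finset.sum_congr ?_ fun _ _ => rfl
      ext L
      simp [hinc]
    simp only [h1, h2, Pi.zero_apply]
  · refine core hs hr _ fun f => ?_
    rw [Submodule.mem_inf, LinearMap.mem_ker, LinearMap.mem_ker, funext_iff]
    have h1 : sumLin (planes p V) k f = ∑ i, f i := finsum_eq_sum_of_fintype f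
    have h2 : ∀ L, tauLin' p V k f L = ∑ P, if r L ⬝ᵥ s P = 0 then f P else 0 := by
      intro L
      have : tauLin' p V k f L = ∑ᶠ P ∈ {P : planes p V | L.1 ≤ P.1}, f P := rfl
      rw [this, finsum_mem_eq_finite_toFinset_sum _ (Set.toFinite _), ← Finset.sum_filter]
      refine Finset.sum_congr ?_ fun _ _ => rfl
      ext P
      simp [hinc, dotProduct_comm]
    simp only [h1, h2, Pi.zero_apply]
end
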